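/- For every ζ with 0 < ζ < 1, the re-parameterized ellipse of Fact 4 is horizontally oriented: a(ζ)/(a(ζ) + c(ζ)) > b(ζ), where c(ζ) = e^{−β/tan β} cos β, a(ζ) = c(ζ) + e^{−π/tan β}, b(ζ) = e^{−β/tan β} sin β and β = arccos ζ; that is, the rescaled real semi-axis a_n = a(ζ)·μ with μ = 1/(a(ζ) + c(ζ)) exceeds the imaginary semi-axis b(ζ). -/

import Mathlib

/-- `-log b` as a function of `u = cot β`. -/
noncomputable def yAux (u : ℝ) : ℝ :=
  u * (Real.pi / 2 - Real.arctan u) + Real.log (1 + u ^ 2) / 2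

lemma yAux_deriv (u : ℝ) : HasDerivAt yAux (Real.pi / 2 - Real.arctan u) u := by
  have hp : (1 + u ^ 2) ≠ 0 := by positivity
  have h1 := (hasDerivAt_id u).mul ((Real.hasDerivAt_arctan u).const_sub (Real.pi / 2))
  have h2 : HasDerivAt (fun x : ℝ => 1 + x ^ 2) (2 * u) u := by
    simpa using ((hasDerivAt_id u).pow 2).const_add 1
  have h3 := h1.add ((h2.log hp).div_const 2)
  refine HasDerivAt.congr_deriv (f := yAux) h3 ?_
  simp only [id]
  field_simp
  ring

lemma yAux_mono : Monotone yAux := by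
  apply monotone_of_deriv_nonneg (fun u => (yAux_deriv u).differentiableAt)
  intro u
  rw [(yAux_deriv u).deriv]
  linarith [Real.arctan_lt_pi_div_two u]

lemma arctan_le_self_aux (u : ℝ) (hu : 0 ≤ u) : Real.arctan u ≤ u := by
  have h := Real.le_tan (Real.arctan_nonneg.2 hu) (Real.arctan_lt_pi_div_two u)
  rwa [Real.tan_arctan] at h

lemma yAux_ge (u : ℝ) (hu : 0 ≤ u) : u * (Real.pi / 2 - u / 2) ≤ yAux u := by
  have hd : ∀ x : ℝ, HasDerivAt (fun x => yAux x - x * (Real.pi / 2 - x / 2))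
      (x - Real.arctan x) x := by
    intro x
    have h := (yAux_deriv x).sub ((hasDerivAt_id x).mul
      (((hasDerivAt_id x).div_const 2).const_sub (Real.pi / 2)))
    refine HasDerivAt.congr_deriv h ?_
    simp only [id]
    ring
  have hm : MonotoneOn (fun x => yAux x - x * (Real.pi / 2 - x / 2)) (Set.Ici 0) := by
    apply monotoneOn_of_deriv_nonneg (convex_Ici 0)
    · exact fun x _ => (hd x).continuousAt.continuousWithinAt
    · exact fun x _ => (hd x).differentiableAt.differentiableWithinAt
    · intro x hx
      rw [interior_Ici] at hx
      rw [(hd x).deriv]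
      linarith [arctan_le_self_aux x (le_of_lt hx)]
  have h := hm (Set.mem_Ici.2 le_rfl) (Set.mem_Ici.2 hu) hu
  simp [yAux] at h
  simp only [yAux]
  linarith

lemma poly_aux (u y : ℝ) (hu : 0 < u) (hu2 : u < 3 / 5) (hy1 : y < 1)
    (hy : u * (157 / 100 - u / 2) ≤ y) :
    u * (1 - y) < (y - y ^ 2 / 2) * (1 - u ^ 2 - 2 * u ^ 4) := by
  set w := u * (157 / 100 - u / 2) with hw
  have hQ : 0 < 1 - u ^ 2 - 2 * u ^ 4 := by
    have : u ^ 2 < 9 / 25 := by nlinarith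
    nlinarith [sq_nonneg u]
  have h1 : w - w ^ 2 / 2 ≤ y - y ^ 2 / 2 := by nlinarith
  have h2 : u * (1 - y) ≤ u * (1 - w) := by nlinarith
  have h3 : 1 - w < (157 / 100 - u / 2) * (1 - w / 2) * (1 - u ^ 2 - 2 * u ^ 4) := by
    have hv : 0 < 3 / 5 - u := by linarith
    have a0 : 0 < (3 / 5 - u) ^ 7 := by positivity
    have a1 : 0 < u * (3 / 5 - u) ^ 6 := by positivity
    have a2 : 0 < u ^ 2 * (3 / 5 - u) ^ 5 := by positivity
    have a3 : 0 < u ^ 3 * (3 / 5 - u) ^ 4 := by positivity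
    have a4 : 0 < u ^ 4 * (3 / 5 - u) ^ 3 := by positivity
    have a5 : 0 < u ^ 5 * (3 / 5 - u) ^ 2 := by positivity
    have a6 : 0 < u ^ 6 * (3 / 5 - u) := by positivity
    have a7 : 0 < u ^ 7 := by positivity
    rw [hw]
    linarith
  have h4 : u * (1 - w) < (w - w ^ 2 / 2) * (1 - u ^ 2 - 2 * u ^ 4) := by
    calc _ < u * ((157 / 100 - u / 2) * (1 - w / 2) * (1 - u ^ 2 - 2 * u ^ 4)) := by gcongr
      _ = _ := by rw [hw]; ring
  nlinarith [mul_le_mul_of_nonneg_right h1 hQ.le]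

lemma main_aux (u y q : ℝ) (hu : 0 < u) (hy : u * (157 / 100 - u / 2) ≤ y)
    (hy2 : 3 / 5 ≤ u → 76 / 100 ≤ y) (hy0 : 0 < y) (hq : Real.exp (-(2 * u ^ 2)) ≤ q) :
    u * (2 * Real.exp (-y) - 1) < Real.exp (-y) * (1 - Real.exp (-y)) * q * (1 + u ^ 2) := by
  have hb := Real.exp_pos (-y)
  have hb1 : Real.exp (-y) < 1 := by simpa using hy0
  have hq0 : 0 < q := (Real.exp_pos _).trans_le hq
  have hR : 0 < Real.exp (-y) * (1 - Real.exp (-y)) * q * (1 + u ^ 2) := by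
    have : 0 < 1 - Real.exp (-y) := by linarith
    positivity
  by_cases hc : Real.exp (-y) ≤ 1 / 2
  · nlinarith
  push Not at hc
  have hmul : Real.exp (-y) * Real.exp y = 1 := by rw [← Real.exp_add]; simp
  have hey := Real.quadratic_le_exp_of_nonneg hy0.le
  have hey2 : Real.exp y < 2 := by nlinarith
  have hy1 : y < 76 / 100 := by nlinarith
  have hu2 : u < 3 / 5 := by
    by_contra h
    linarith [hy2 (not_lt.1 h)]
  have hp := poly_aux u y hu hu2 (by linarith) hy
  have hq1 : 1 - 2 * u ^ 2 ≤ q := by linarith [Real.add_one_le_exp (-(2 * u ^ 2))]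
  have hq2 : 1 - u ^ 2 - 2 * u ^ 4 ≤ q * (1 + u ^ 2) := by nlinarith [sq_nonneg u]
  have h1b : y - y ^ 2 / 2 ≤ 1 - Real.exp (-y) := by
    -- exp(-y) ≤ 1/(1+y+y^2/2)
    have h : Real.exp (-y) * (1 + y + y ^ 2 / 2) ≤ 1 := by nlinarith
    have h' : (1 - y + y ^ 2 / 2) * (1 + y + y ^ 2 / 2) ≥ 1 := by nlinarith [sq_nonneg (y ^ 2)]
    have hpos : 0 < 1 + y + y ^ 2 / 2 := by positivity
    have := le_of_mul_le_mul_right (h.trans h') hpos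
    linarith
  have hypos : 0 ≤ y - y ^ 2 / 2 := by nlinarith
  have h5 : u * (2 - Real.exp y) < (1 - Real.exp (-y)) * (q * (1 + u ^ 2)) := by
    have e1 : u * (2 - Real.exp y) ≤ u * (1 - y) := by
      apply mul_le_mul_of_nonneg_left _ hu.le
      linarith [Real.add_one_le_exp y]
    have e2 := mul_le_mul_of_nonneg_left hq2 hypos
    have e3 : (y - y ^ 2 / 2) * (q * (1 + u ^ 2)) ≤ (1 - Real.exp (-y)) * (q * (1 + u ^ 2)) :=
      mul_le_mul_of_nonneg_right h1b (by positivity)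
    linarith
  have h6 := mul_lt_mul_of_pos_left h5 hb
  have h7 : Real.exp (-y) * (u * (2 - Real.exp y)) = u * (2 * Real.exp (-y) - 1) := by
    linear_combination (-u) * hmul
  linarith

/-- For every `ζ ∈ (0, 1)`, the re-parameterized ellipse of Fact 4 is horizontally
oriented: `a(ζ)/(a(ζ) + c(ζ)) > b(ζ)`, where, with `β = arccos ζ`,
`c(ζ) = e^{-β/tan β} cos β`, `a(ζ) = c(ζ) + e^{-π/tan β}` and
`b(ζ) = e^{-β/tan β} sin β`. -/
theorem reparameterized_ellipse_horizontal (ζ : ℝ) (h1 : 0 < ζ) (h2 : ζ < 1) :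
    (Real.exp (-(Real.arccos ζ) / Real.tan (Real.arccos ζ)) * Real.cos (Real.arccos ζ)
        + Real.exp (-Real.pi / Real.tan (Real.arccos ζ)))
      / ((Real.exp (-(Real.arccos ζ) / Real.tan (Real.arccos ζ)) * Real.cos (Real.arccos ζ)
          + Real.exp (-Real.pi / Real.tan (Real.arccos ζ)))
        + Real.exp (-(Real.arccos ζ) / Real.tan (Real.arccos ζ)) * Real.cos (Real.arccos ζ))
    > Real.exp (-(Real.arccos ζ) / Real.tan (Real.arccos ζ)) * Real.sin (Real.arccos ζ) := by
  have hβ0 : 0 < Real.arccos ζ := Real.arccos_pos.2 h2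
  have hβ1 : Real.arccos ζ < Real.pi / 2 := Real.arccos_lt_pi_div_two.2 h1
  set β := Real.arccos ζ with hβ
  clear_value β
  have hs : 0 < Real.sin β := Real.sin_pos_of_pos_of_lt_pi hβ0 (by linarith)
  have hk : 0 < Real.cos β := Real.cos_pos_of_mem_Ioo ⟨by linarith, hβ1⟩
  obtain ⟨u, hu⟩ : ∃ u, u = Real.cos β / Real.sin β := ⟨_, rfl⟩
  have hu0 : 0 < u := by rw [hu]; positivity
  have hku : Real.cos β = u * Real.sin β := by rw [hu]; field_simp
  have hat : Real.arctan u = Real.pi / 2 - β := by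
    have : u = Real.tan (Real.pi / 2 - β) := by
      rw [Real.tan_eq_sin_div_cos, Real.sin_pi_div_two_sub, Real.cos_pi_div_two_sub, hu]
    rw [this, Real.arctan_tan] <;> linarith
  have hss : Real.sin β ^ 2 * (1 + u ^ 2) = 1 := by
    have := Real.sin_sq_add_cos_sq β
    rw [hku] at this
    linarith
  have hE : -β / Real.tan β = -(β * u) := by
    rw [Real.tan_eq_sin_div_cos, hu]; field_simp
  have hP : -Real.pi / Real.tan β = -(Real.pi * u) := by
    rw [Real.tan_eq_sin_div_cos, hu]; field_simp
  rw [hE, hP]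
  have hsl : Real.log (Real.sin β) = -(Real.log (1 + u ^ 2) / 2) := by
    have h := congrArg Real.log hss
    rw [Real.log_mul (by positivity) (by positivity), Real.log_pow, Real.log_one] at h
    push_cast at h
    linarith
  have hb : Real.exp (-(β * u)) * Real.sin β = Real.exp (-yAux u) := by
    rw [← Real.exp_log hs, ← Real.exp_add, hsl, yAux, hat]
    congr 1
    ring
  have hpi := Real.pi_gt_d2
  have hy : u * (157 / 100 - u / 2) ≤ yAux u := by
    refine le_trans ?_ (yAux_ge u hu0.le)
    apply mul_le_mul_of_nonneg_left _ hu0.le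
    linarith
  have hy2 : 3 / 5 ≤ u → 76 / 100 ≤ yAux u := by
    intro h
    have h1 := yAux_mono h
    have h2 := yAux_ge (3 / 5) (by norm_num)
    linarith
  have hy0 : 0 < yAux u := by
    have e1 : 0 < u * β := by positivity
    have e2 : 0 ≤ Real.log (1 + u ^ 2) := Real.log_nonneg (by nlinarith)
    rw [yAux, hat]
    linarith
  have hq : Real.exp (-(2 * u ^ 2)) ≤ Real.exp (-(2 * (Real.pi / 2 - β) * u)) := by
    apply Real.exp_le_exp.2
    have := arctan_le_self_aux u hu0.le
    rw [hat] at this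
    nlinarith
  have hm := main_aux u (yAux u) _ hu0 hy hy2 hy0 hq
  have hD : Real.exp (-(Real.pi * u)) = Real.exp (-(β * u)) *
      (Real.exp (-(β * u)) * Real.exp (-(2 * (Real.pi / 2 - β) * u))) := by
    rw [← Real.exp_add, ← Real.exp_add]
    congr 1
    ring
  rw [← hb] at hm
  rw [hD, hku, gt_iff_lt, lt_div_iff₀ (by positivity)]
  generalize Real.exp (-(2 * (Real.pi / 2 - β) * u)) = q at *
  have hEp := Real.exp_pos (-(β * u))
  generalize Real.exp (-(β * u)) = E at *
  generalize Real.sin β = s at *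
  have h8 := mul_lt_mul_of_pos_left hm (mul_pos hEp hs)
  have h9 : E * s * (E * s * (1 - E * s) * q * (1 + u ^ 2)) = E * (E * q) * (1 - E * s) := by
    linear_combination (E * (E * q) * (1 - E * s)) * hss
  linarith
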